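/- Let X be a Banach space with an unconditional Schauder basis which admits a Lipschitz, C^p-smooth bump function. There exists a constant C₀ > 1, depending only on X (in particular independent of ε), such that: for every subset Y ⊆ X, every η-Lipschitz function f : Y → ℝ, and every ε > 0, there exists a C^p-smooth function K : X → ℝ with |f(y) − K(y)| < ε for all y ∈ Y and with Lipschitz constant of K no larger than C₀η. -/

import Mathlib

open Function Bornology

/-- `X` has an unconditional Schauder basis: every `x` has a unique expansion
`x = ∑ⱼ xⱼ eⱼ` converging unconditionally (unconditional convergence = `HasSum`). -/
def HasUnconditionalSchauderBasis (X : Type*) [NormedAddCommGroup X] [NormedSpace ℝ X] : Prop :=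
  ∃ e : ℕ → X, ∀ x : X, ∃! a : ℕ → ℝ, HasSum (fun j => a j • e j) x

/-- `X` admits a Lipschitz, `C^p`-smooth bump function. -/
def HasLipschitzSmoothBump (X : Type*) [NormedAddCommGroup X] [NormedSpace ℝ X] (p : ℕ∞) : Prop :=
  ∃ b : X → ℝ, ContDiff ℝ p b ∧ (∃ C : NNReal, LipschitzWith C b) ∧
    IsBounded (closure (support b)) ∧ (support b).Nonempty

open Filter Topology

/-- A smooth ramp: it vanishes on `(-∞, 1]`, has slope in `[0, 1]`, and lies above `u - 2`. -/
noncomputable def smoothRamp (u : ℝ) : ℝ := ∫ t in (0 : ℝ)..u, Real.smoothTransition (t - 1)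

lemma continuous_smoothTransition_sub_one : Continuous fun t : ℝ => Real.smoothTransition (t - 1) :=
  Real.smoothTransition.continuous.comp (continuous_id.sub continuous_const)

lemma hasDerivAt_smoothRamp (u : ℝ) :
    HasDerivAt smoothRamp (Real.smoothTransition (u - 1)) u :=
  intervalIntegral.integral_hasDerivAt_right
    (continuous_smoothTransition_sub_one.intervalIntegrable _ _)
    (continuous_smoothTransition_sub_one.stronglyMeasurableAtFilter _ _)
    continuous_smoothTransition_sub_one.continuousAt

lemma contDiff_smoothRamp (p : ℕ∞) : ContDiff ℝ p smoothRamp := by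
  have h : ContDiff ℝ ((⊤ : ℕ∞) : WithTop ℕ∞) smoothRamp := by
    rw [contDiff_infty_iff_deriv]
    refine ⟨fun u => (hasDerivAt_smoothRamp u).differentiableAt, ?_⟩
    have : deriv smoothRamp = fun u => Real.smoothTransition (u - 1) :=
      funext fun u => (hasDerivAt_smoothRamp u).deriv
    rw [this]
    exact Real.smoothTransition.contDiff.comp (contDiff_id.sub contDiff_const)
  exact h.of_le (by exact_mod_cast le_top)

lemma monotone_smoothRamp : Monotone smoothRamp :=
  monotone_of_deriv_nonneg (fun u => (hasDerivAt_smoothRamp u).differentiableAt) fun u => by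
    rw [(hasDerivAt_smoothRamp u).deriv]
    exact Real.smoothTransition.nonneg _

lemma monotone_sub_smoothRamp : Monotone fun u => u - smoothRamp u := by
  have h (u : ℝ) : HasDerivAt (fun u => u - smoothRamp u)
      (1 - Real.smoothTransition (u - 1)) u := (hasDerivAt_id' u).sub (hasDerivAt_smoothRamp u)
  refine monotone_of_deriv_nonneg (fun u => (h u).differentiableAt) fun u => ?_
  rw [(h u).deriv]
  linarith [Real.smoothTransition.le_one (u - 1)]

lemma smoothRamp_of_le_one {u : ℝ} (hu : u ≤ 1) : smoothRamp u = 0 := by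
  refine (intervalIntegral.integral_congr (g := fun _ => (0 : ℝ)) fun t ht => ?_).trans
    intervalIntegral.integral_zero
  refine Real.smoothTransition.zero_of_nonpos ?_
  have := ht.2.trans (max_le zero_le_one hu)
  linarith

lemma smoothRamp_nonneg (u : ℝ) : 0 ≤ smoothRamp u := by
  rcases le_total u 1 with h | h
  · exact (smoothRamp_of_le_one h).ge
  · exact (smoothRamp_of_le_one le_rfl).ge.trans (monotone_smoothRamp h)

lemma smoothRamp_le_max (u : ℝ) : smoothRamp u ≤ max u 0 := by
  rcases le_total u 0 with h | h
  · rw [smoothRamp_of_le_one (h.trans zero_le_one)]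
    exact le_max_right _ _
  · have h1 := monotone_sub_smoothRamp h
    simp only [smoothRamp_of_le_one zero_le_one] at h1
    exact le_max_of_le_left (by linarith)

lemma sub_two_le_smoothRamp (u : ℝ) : u - 2 ≤ smoothRamp u := by
  rcases le_total u 2 with h | h
  · linarith [smoothRamp_nonneg u]
  · have hconst : ∀ t ∈ Set.Ici (2 : ℝ), Real.smoothTransition (t - 1) = 1 := fun t ht =>
      Real.smoothTransition.one_of_one_le (by linarith [Set.mem_Ici.1 ht])
    have hsplit : smoothRamp u = smoothRamp 2 + ∫ t in (2 : ℝ)..u, Real.smoothTransition (t - 1) :=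
      (intervalIntegral.integral_add_adjacent_intervals
        (continuous_smoothTransition_sub_one.intervalIntegrable _ _)
        (continuous_smoothTransition_sub_one.intervalIntegrable _ _)).symm
    have hint : ∫ t in (2 : ℝ)..u, Real.smoothTransition (t - 1) = ∫ _ in (2 : ℝ)..u, (1 : ℝ) :=
      intervalIntegral.integral_congr fun t ht =>
        hconst t (by rw [Set.uIcc_of_le h] at ht; exact ht.1)
    rw [hsplit, hint, intervalIntegral.integral_const, smul_eq_mul, mul_one]
    linarith [smoothRamp_nonneg 2]

lemma abs_smoothRamp_sub_le (u v : ℝ) : |smoothRamp u - smoothRamp v| ≤ |u - v| := by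
  wlog h : v ≤ u generalizing u v
  · rw [abs_sub_comm, abs_sub_comm u v]
    exact this v u (le_of_not_ge h)
  have h1 := monotone_smoothRamp h
  have h2 := monotone_sub_smoothRamp h
  simp only at h2
  rw [abs_of_nonneg (by linarith), abs_of_nonneg (by linarith)]
  linarith

/-- `a + smoothRamp (b - a)` is a smooth approximation of `max a b`; like `max`, it is nonexpansive
for the supremum norm. -/
lemma abs_add_smoothRamp_sub_le {a b a' b' t : ℝ} (ha : |a - a'| ≤ t) (hb : |b - b'| ≤ t) :
    |a + smoothRamp (b - a) - (a' + smoothRamp (b' - a'))| ≤ t := by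
  have key : ∀ {a b a' b' : ℝ}, a ≤ a' + t → b ≤ b' + t →
      a + smoothRamp (b - a) ≤ a' + smoothRamp (b' - a') + t := by
    intro a b a' b' ha hb
    have h1 := monotone_smoothRamp (show b - a ≤ b' + t - a by linarith)
    have h2 := monotone_sub_smoothRamp (show b' - a' ≤ b' + t - a by linarith)
    simp only at h2
    linarith
  rw [abs_le] at ha hb ⊢
  have h1 := key (a := a) (a' := a') (b := b) (b' := b') (by linarith) (by linarith)
  have h2 := key (a := a') (a' := a) (b := b') (b' := b) (by linarith) (by linarith)
  constructor <;> linarith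

/-- Iterated smooth maximum of `a, g 0, g 1, …, g (n - 1)`. -/
noncomputable def softMax {X : Type*} (a : X → ℝ) (g : ℕ → X → ℝ) : ℕ → X → ℝ
  | 0 => a
  | n + 1 => fun x => softMax a g n x + smoothRamp (g n x - softMax a g n x)

section softMax

variable {X : Type*} {a : X → ℝ} {g : ℕ → X → ℝ}

lemma softMax_succ (a : X → ℝ) (g : ℕ → X → ℝ) (n : ℕ) (x : X) :
    softMax a g (n + 1) x = softMax a g n x + smoothRamp (g n x - softMax a g n x) := rfl

lemma monotone_softMax (a : X → ℝ) (g : ℕ → X → ℝ) (x : X) :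
    Monotone fun n => softMax a g n x :=
  monotone_nat_of_le_succ fun n => by
    simp only [softMax_succ]
    linarith [smoothRamp_nonneg (g n x - softMax a g n x)]

lemma le_softMax (a : X → ℝ) (g : ℕ → X → ℝ) (n : ℕ) (x : X) : a x ≤ softMax a g n x :=
  monotone_softMax a g x (Nat.zero_le n)

lemma sub_two_le_softMax (a : X → ℝ) (g : ℕ → X → ℝ) {n m : ℕ} (h : n < m) (x : X) :
    g n x - 2 ≤ softMax a g m x := by
  have h1 := monotone_softMax a g x (Nat.succ_le_of_lt h)
  simp only [Nat.succ_eq_add_one, softMax_succ] at h1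
  linarith [sub_two_le_smoothRamp (g n x - softMax a g n x)]

lemma softMax_le {x : X} {B : ℝ} {m : ℕ} (ha : a x ≤ B) (hg : ∀ n < m, g n x ≤ B) :
    softMax a g m x ≤ B := by
  induction m with
  | zero => exact ha
  | succ m ih =>
    have h1 := ih fun n hn => hg n (hn.trans m.lt_succ_self)
    have h2 := hg m m.lt_succ_self
    rw [softMax_succ]
    have h3 := smoothRamp_le_max (g m x - softMax a g m x)
    have h4 : max (g m x - softMax a g m x) 0 ≤ B - softMax a g m x :=
      max_le (by linarith) (by linarith)
    linarith

lemma softMax_eq_of_le {x : X} {N : ℕ} (h : ∀ n ≥ N, g n x ≤ softMax a g n x + 1) {n : ℕ}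
    (hn : N ≤ n) : softMax a g n x = softMax a g N x := by
  induction n, hn using Nat.le_induction with
  | base => rfl
  | succ n hn ih =>
    rw [softMax_succ, smoothRamp_of_le_one (by linarith [h n hn]), add_zero, ih]

variable [NormedAddCommGroup X]

lemma abs_softMax_sub_le {L : ℝ} (ha : ∀ x y, |a x - a y| ≤ L * ‖x - y‖)
    (hg : ∀ n x y, |g n x - g n y| ≤ L * ‖x - y‖) (n : ℕ) (x y : X) :
    |softMax a g n x - softMax a g n y| ≤ L * ‖x - y‖ := by
  induction n with
  | zero => exact ha x y
  | succ n ih => exact abs_add_smoothRamp_sub_le ih (hg n x y)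

variable [NormedSpace ℝ X]

lemma contDiff_softMax {p : ℕ∞} (ha : ContDiff ℝ p a) (hg : ∀ n, ContDiff ℝ p (g n)) (n : ℕ) :
    ContDiff ℝ p (softMax a g n) := by
  induction n with
  | zero => exact ha
  | succ n ih => exact ih.add ((contDiff_smoothRamp p).comp ((hg n).sub ih))

end softMax

/-- A sequence of `C^p`, `L`-Lipschitz functions which is locally eventually constant converges
to a `C^p`, `L`-Lipschitz function. -/
lemma exists_contDiff_of_locally_eventually_eq {X : Type*} [NormedAddCommGroup X]
    [NormedSpace ℝ X] {p : ℕ∞} {K : ℕ → X → ℝ} {L : ℝ} (hK : ∀ n, ContDiff ℝ p (K n))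
    (hL : ∀ n x y, |K n x - K n y| ≤ L * ‖x - y‖)
    (hloc : ∀ x, ∃ N, ∀ᶠ y in 𝓝 x, ∀ n ≥ N, K n y = K N y) :
    ∃ F : X → ℝ, ContDiff ℝ p F ∧ (∀ x y, |F x - F y| ≤ L * ‖x - y‖) ∧
      ∀ x, ∃ N, ∀ n ≥ N, K n x = F x := by
  choose N hN using hloc
  have hlim : ∀ x y, (∀ n ≥ N x, K n y = K (N x) y) → K (N y) y = K (N x) y := by
    intro x y h
    rw [← (hN y).self_of_nhds (max (N x) (N y)) (le_max_right _ _)]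
    exact h _ (le_max_left _ _)
  refine ⟨fun x => K (N x) x, ?_, ?_, fun x => ⟨N x, (hN x).self_of_nhds⟩⟩
  · rw [contDiff_iff_contDiffAt]
    intro x
    refine (hK (N x)).contDiffAt.congr_of_eventuallyEq ?_
    filter_upwards [hN x] with y hy using hlim x y hy
  · intro x y
    have hx := (hN x).self_of_nhds (max (N x) (N y)) (le_max_left _ _)
    have hy := (hN y).self_of_nhds (max (N x) (N y)) (le_max_right _ _)
    simpa only [hx, hy] using hL (max (N x) (N y)) x y

section Bump

variable {X : Type*} [NormedAddCommGroup X] [NormedSpace ℝ X] {p : ℕ∞}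

lemma HasLipschitzSmoothBump.exists_normalized (h : HasLipschitzSmoothBump X p) :
    ∃ (b : X → ℝ) (c R : ℝ), ContDiff ℝ p b ∧ 0 ≤ c ∧ 0 < R ∧
      (∀ x y, |b x - b y| ≤ c * ‖x - y‖) ∧ (∀ x, ‖x‖ ≤ 1 → 8 ≤ b x) ∧
      ∀ x, R < ‖x‖ → b x = 0 := by
  obtain ⟨b, hb, ⟨C, hC⟩, hbdd, x₀, hx₀⟩ := h
  obtain ⟨R, hR⟩ := hbdd.exists_norm_le
  have hv : 0 < |b x₀| := abs_pos.2 hx₀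
  obtain ⟨r, hr, hCr⟩ : ∃ r : ℝ, 0 < r ∧ C * r ≤ |b x₀| / 2 := by
    refine ⟨|b x₀| / (2 * (C + 1)), by positivity, ?_⟩
    rw [mul_div_assoc', div_le_div_iff₀ (by positivity) (by positivity)]
    nlinarith [C.coe_nonneg]
  set s : ℝ := 16 / b x₀ with hs
  have hlip : ∀ x y, |b x - b y| ≤ C * ‖x - y‖ := fun x y => by
    simpa [Real.dist_eq, dist_eq_norm] using hC.dist_le_mul x y
  refine ⟨fun x => s * b (x₀ + r • x), |s| * (C * r), (|R| + ‖x₀‖ + 1) / r,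
    contDiff_const.mul (hb.comp (contDiff_const.add (contDiff_const_smul r))),
    by positivity, by positivity, fun x y => ?_, fun x hx => ?_, fun x hx => ?_⟩
  · rw [← mul_sub, abs_mul, mul_assoc]
    refine mul_le_mul_of_nonneg_left ((hlip _ _).trans_eq ?_) (abs_nonneg _)
    rw [add_sub_add_left_eq_sub, ← smul_sub, norm_smul, Real.norm_of_nonneg hr.le, mul_assoc]
  · have h1 : |b (x₀ + r • x) - b x₀| ≤ |b x₀| / 2 := by
      refine (hlip _ _).trans (le_trans ?_ hCr)
      rw [add_sub_cancel_left, norm_smul, Real.norm_of_nonneg hr.le]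
      exact mul_le_mul_of_nonneg_left (by nlinarith) C.coe_nonneg
    have h2 : |s * b (x₀ + r • x) - 16| ≤ 8 := by
      have : s * b (x₀ + r • x) - 16 = s * (b (x₀ + r • x) - b x₀) := by
        rw [mul_sub, hs, div_mul_cancel₀ _ hx₀]
      rw [this, abs_mul]
      refine (mul_le_mul_of_nonneg_left h1 (abs_nonneg _)).trans_eq ?_
      rw [hs, abs_div]
      field_simp
      norm_num
    linarith [(abs_le.1 h2).1]
  · refine mul_eq_zero_of_right _ ?_
    by_contra hne
    have h1 := hR _ (subset_closure (mem_support.2 hne))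
    rw [div_lt_iff₀ hr] at hx
    have h2 : ‖r • x‖ ≤ ‖x₀ + r • x‖ + ‖x₀‖ := by
      simpa using norm_sub_le (x₀ + r • x) x₀
    rw [norm_smul, Real.norm_of_nonneg hr.le] at h2
    nlinarith [le_abs_self R]

/-- A Lipschitz smooth bump yields a `C^p` Lipschitz substitute for the norm at large scale. -/
lemma HasLipschitzSmoothBump.exists_coarse_norm (h : HasLipschitzSmoothBump X p) :
    ∃ (d : X → ℝ) (C A : ℝ), ContDiff ℝ p d ∧ 0 ≤ C ∧ 0 ≤ A ∧
      (∀ x y, |d x - d y| ≤ C * ‖x - y‖) ∧ d 0 = 0 ∧ ∀ x, ‖x‖ - A ≤ d x := by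
  obtain ⟨b, c, R, hb, hc, hR, hlip, hb8, hb0⟩ := h.exists_normalized
  set g : ℕ → X → ℝ := fun n x => 2 ^ n * smoothRamp (9 - b (((2 : ℝ) ^ n)⁻¹ • x)) with hg
  have hgcd : ∀ n, ContDiff ℝ p (g n) := fun n =>
    contDiff_const.mul ((contDiff_smoothRamp p).comp
      (contDiff_const.sub (hb.comp (contDiff_const_smul _))))
  have hglip : ∀ n x y, |g n x - g n y| ≤ c * ‖x - y‖ := by
    intro n x y
    have h2 : (0 : ℝ) < 2 ^ n := by positivity
    rw [hg, ← mul_sub, abs_mul, abs_of_pos h2]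
    have h3 := (abs_smoothRamp_sub_le (9 - b (((2 : ℝ) ^ n)⁻¹ • x))
      (9 - b (((2 : ℝ) ^ n)⁻¹ • y))).trans_eq (by rw [sub_sub_sub_cancel_left, abs_sub_comm])
    refine (mul_le_mul_of_nonneg_left (h3.trans (hlip _ _)) h2.le).trans_eq ?_
    rw [← smul_sub, norm_smul, norm_inv, Real.norm_of_nonneg h2.le]
    field_simp
  have hgzero : ∀ n x, ‖x‖ ≤ 2 ^ n → g n x = 0 := by
    intro n x hx
    have h2 : (0 : ℝ) < 2 ^ n := by positivity
    have : ‖((2 : ℝ) ^ n)⁻¹ • x‖ ≤ 1 := by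
      rw [norm_smul, norm_inv, Real.norm_of_nonneg h2.le, inv_mul_le_iff₀ h2]
      simpa using hx
    exact mul_eq_zero_of_right _ (smoothRamp_of_le_one (by linarith [hb8 _ this]))
  have hgfar : ∀ n x, R * 2 ^ n < ‖x‖ → 2 ^ n ≤ g n x := by
    intro n x hx
    have h2 : (0 : ℝ) < 2 ^ n := by positivity
    have : R < ‖((2 : ℝ) ^ n)⁻¹ • x‖ := by
      rwa [norm_smul, norm_inv, Real.norm_of_nonneg h2.le, lt_inv_mul_iff₀ h2, mul_comm]
    simp only [hg, hb0 _ this, sub_zero]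
    nlinarith [sub_two_le_smoothRamp 9]
  obtain ⟨d, hd, hdlip, hdlim⟩ := exists_contDiff_of_locally_eventually_eq
    (contDiff_softMax (a := fun _ => 0) contDiff_const hgcd)
    (abs_softMax_sub_le (a := fun _ => 0)
      (fun x y => by rw [sub_zero, abs_zero]; positivity) hglip) (by
    intro x
    obtain ⟨N, hN⟩ := pow_unbounded_of_one_lt ‖x‖ one_lt_two
    refine ⟨N, ?_⟩
    filter_upwards [continuous_norm.continuousAt.eventually_lt continuousAt_const hN] with y hy n hn
    refine softMax_eq_of_le (fun k hk => ?_) hn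
    rw [hgzero k y (hy.le.trans (pow_le_pow_right₀ one_le_two hk))]
    linarith [le_softMax (fun _ => 0) g k y])
  have hdnonneg : ∀ x, 0 ≤ d x := fun x => by
    obtain ⟨N, hN⟩ := hdlim x
    rw [← hN N le_rfl]
    exact le_softMax (fun _ => 0) g N x
  have hdfar : ∀ x n, R * 2 ^ n < ‖x‖ → 2 ^ n - 2 ≤ d x := fun x n hn => by
    obtain ⟨N, hN⟩ := hdlim x
    rw [← hN (max N (n + 1)) (le_max_left _ _)]
    linarith [hgfar n x hn,
      sub_two_le_softMax (fun _ => 0) g (lt_of_lt_of_le n.lt_succ_self (le_max_right N (n + 1))) x]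
  have hd0 : d 0 = 0 := by
    obtain ⟨N, hN⟩ := hdlim 0
    refine le_antisymm ?_ (hdnonneg 0)
    rw [← hN N le_rfl]
    exact softMax_le le_rfl fun n _ => (hgzero n 0 (by rw [norm_zero]; positivity)).le
  refine ⟨fun x => 2 * R * d x, 2 * R * c, 4 * R, contDiff_const.mul hd, by positivity,
    by positivity, fun x y => ?_, by simp only [hd0, mul_zero], fun x => ?_⟩
  · rw [← mul_sub, abs_mul, abs_of_pos (by positivity : 0 < 2 * R), mul_assoc (2 * R)]
    exact mul_le_mul_of_nonneg_left (hdlip x y) (by positivity)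
  · rcases le_or_gt ‖x‖ R with hx | hx
    · nlinarith [hdnonneg x, mul_nonneg hR.le (hdnonneg x)]
    · have hx' : ∃ n : ℕ, ‖x‖ ≤ R * 2 ^ n := by
        obtain ⟨n, hn⟩ := pow_unbounded_of_one_lt (‖x‖ / R) one_lt_two
        exact ⟨n, by rw [div_lt_iff₀ hR] at hn; linarith⟩
      obtain ⟨n, hn, hlt⟩ : ∃ n : ℕ, ‖x‖ ≤ R * 2 ^ (n + 1) ∧ R * 2 ^ n < ‖x‖ := by
        classical
        have hpos : Nat.find hx' ≠ 0 := fun h0 => by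
          have := Nat.find_spec hx'
          rw [h0, pow_zero, mul_one] at this
          linarith
        obtain ⟨n, hn⟩ := Nat.exists_eq_succ_of_ne_zero hpos
        refine ⟨n, ?_, not_le.1 (Nat.find_min hx' (by omega))⟩
        have := Nat.find_spec hx'
        rwa [hn] at this
      have := mul_le_mul_of_nonneg_left (hdfar x n hlt) (by positivity : 0 ≤ 2 * R)
      rw [pow_succ] at hn
      linarith

/-- On a separable space with a Lipschitz `C^p` bump, every `1`-Lipschitz function is at bounded
distance from a `C^p` function whose Lipschitz constant is controlled. -/
lemma HasLipschitzSmoothBump.exists_coarse_approx [TopologicalSpace.SeparableSpace X]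
    (h : HasLipschitzSmoothBump X p) :
    ∃ C A : ℝ, 0 ≤ C ∧ 0 ≤ A ∧ ∀ f : X → ℝ, (∀ x y, |f x - f y| ≤ ‖x - y‖) →
      ∃ K : X → ℝ, ContDiff ℝ p K ∧ (∀ x y, |K x - K y| ≤ C * ‖x - y‖) ∧
        ∀ x, |f x - K x| ≤ A := by
  obtain ⟨b, c, R, hb, hc, hR, hblip, hb8, hb0⟩ := h.exists_normalized
  obtain ⟨d, C₁, A₁, hd, hC₁, hA₁, hdlip, hd0, hdnorm⟩ := h.exists_coarse_norm
  set Q : ℝ := A₁ + R + C₁ * R + 2 with hQ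
  have hQ0 : 0 ≤ Q := by positivity
  refine ⟨C₁ + Q * c, 5 * Q, by positivity, by positivity, fun f hf => ?_⟩
  set u : ℕ → X := TopologicalSpace.denseSeq X with hu
  set β : ℕ → X → ℝ := fun n x => b (x - u n) with hβ
  set M : ℕ → X → ℝ := softMax (fun _ => 0) β with hM
  set g : ℕ → X → ℝ := fun n x => f (u n) - d (x - u n) - Q * M n x with hg
  have hMlip : ∀ n x y, |M n x - M n y| ≤ c * ‖x - y‖ :=
    abs_softMax_sub_le (fun x y => by rw [sub_zero, abs_zero]; positivity) fun n x y => by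
      simpa using hblip (x - u n) (y - u n)
  have hgcd : ∀ n, ContDiff ℝ p (g n) := fun n =>
    (contDiff_const.sub (hd.comp (contDiff_id.sub contDiff_const))).sub
      (contDiff_const.mul (contDiff_softMax contDiff_const
        (fun k => hb.comp (contDiff_id.sub contDiff_const)) n))
  have hglip : ∀ n x y, |g n x - g n y| ≤ (C₁ + Q * c) * ‖x - y‖ := by
    intro n x y
    have h1 := hdlip (x - u n) (y - u n)
    rw [sub_sub_sub_cancel_right, abs_le] at h1
    have h2 := abs_le.1 (hMlip n x y)
    have h3 := mul_le_mul_of_nonneg_left h2.1 hQ0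
    have h4 := mul_le_mul_of_nonneg_left h2.2 hQ0
    rw [abs_le]
    simp only [hg]
    constructor <;> linarith
  have hgle : ∀ n x, g n x ≤ f x + A₁ - Q * M n x := by
    intro n x
    have h1 := (abs_le.1 (hf x (u n))).1
    have h2 := hdnorm (x - u n)
    simp only [hg]
    linarith
  have hgle' : ∀ n x, g n x ≤ f x + A₁ := fun n x => by
    linarith [hgle n x, mul_nonneg hQ0 (le_softMax (fun _ => 0) β n x)]
  have hlate : ∀ x j n, ‖x - u j‖ ≤ 1 → j < n → g n x ≤ f x + A₁ - Q * 6 := by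
    intro x j n hx hjn
    have h1 : (6 : ℝ) ≤ M n x := by
      linarith [hb8 _ hx, sub_two_le_softMax (fun _ => 0) β hjn x]
    linarith [hgle n x, mul_le_mul_of_nonneg_left h1 hQ0]
  have hgood : ∀ x j, ‖x - u j‖ ≤ 1 → ∃ i ≤ j, f x - R - C₁ * R - Q * 4 ≤ g i x := by
    classical
    intro x j hx
    have hex : ∃ i, 4 ≤ β i x := ⟨j, by linarith [hb8 _ hx]⟩
    refine ⟨Nat.find hex, Nat.find_min' hex (by linarith [hb8 _ hx]), ?_⟩
    have hspec := Nat.find_spec hex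
    have hmin : ∀ k < Nat.find hex, β k x ≤ 4 := fun k hk => (not_le.1 (Nat.find_min hex hk)).le
    set i := Nat.find hex
    have hnorm : ‖x - u i‖ ≤ R := by
      by_contra hlt
      rw [hβ] at hspec
      linarith [hb0 _ (not_le.1 hlt)]
    have hM4 : M i x ≤ 4 := softMax_le (by norm_num) hmin
    have h1 := (abs_le.1 (hf x (u i))).2
    have h2 := (abs_le.1 (hdlip (x - u i) 0)).2
    rw [hd0, sub_zero, sub_zero] at h2
    simp only [hg]
    linarith [mul_le_mul_of_nonneg_left hM4 hQ0, mul_le_mul_of_nonneg_left hnorm hC₁]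
  have hlow : ∀ x j n, ‖x - u j‖ ≤ 1 → j < n →
      f x - R - C₁ * R - Q * 4 - 2 ≤ softMax (g 0) g n x := by
    intro x j n hx hjn
    obtain ⟨i, hij, hi⟩ := hgood x j hx
    linarith [sub_two_le_softMax (g 0) g (hij.trans_lt hjn) x]
  have hdense : ∀ x, ∃ j, ‖x - u j‖ < 1 := fun x => by
    obtain ⟨j, hj⟩ := (TopologicalSpace.denseRange_denseSeq X).exists_dist_lt x one_pos
    exact ⟨j, by rwa [dist_eq_norm] at hj⟩
  obtain ⟨K, hK, hKlip, hKlim⟩ := exists_contDiff_of_locally_eventually_eq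
    (contDiff_softMax (hgcd 0) hgcd) (abs_softMax_sub_le (hglip 0) hglip) (by
    intro x
    obtain ⟨j, hj⟩ := hdense x
    refine ⟨j + 1, ?_⟩
    have hcont : Continuous fun y => ‖y - u j‖ := (continuous_id.sub continuous_const).norm
    filter_upwards [hcont.continuousAt.eventually_lt continuousAt_const hj] with y hy n hn
    refine softMax_eq_of_le (fun k hk => ?_) hn
    linarith [hlow y j k hy.le hk, hlate y j k hy.le hk])
  refine ⟨K, hK, hKlip, fun x => ?_⟩
  obtain ⟨N, hN⟩ := hKlim x
  obtain ⟨j, hj⟩ := hdense x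
  rw [← hN (max N (j + 1)) (le_max_left _ _), abs_le]
  have h1 := hlow x j _ hj.le (lt_of_lt_of_le j.lt_succ_self (le_max_right N (j + 1)))
  have h2 := softMax_le (m := max N (j + 1)) (hgle' 0 x) fun n _ => hgle' n x
  have h3 := mul_nonneg hC₁ hR.le
  constructor <;> linarith

end Bump

lemma HasUnconditionalSchauderBasis.separableSpace {X : Type*} [NormedAddCommGroup X]
    [NormedSpace ℝ X] (h : HasUnconditionalSchauderBasis X) :
    TopologicalSpace.SeparableSpace X := by
  obtain ⟨e, he⟩ := h
  rw [← TopologicalSpace.isSeparable_univ_iff]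
  refine ((Set.countable_range e).isSeparable.span (R := ℝ)).closure.mono fun x _ => ?_
  obtain ⟨a, ha, -⟩ := he x
  exact mem_closure_of_tendsto ha (Eventually.of_forall fun s =>
    Submodule.sum_mem _ fun j _ => Submodule.smul_mem _ _ (Submodule.subset_span ⟨j, rfl⟩))

/-- Theorem 1 (second part, real-valued, arbitrary subset): there is `C₀ > 1` depending
only on `X` such that every `η`-Lipschitz `f : Y → ℝ` on any subset `Y ⊆ X` can be
`ε`-approximated on `Y` by a `C^p`-smooth, `C₀η`-Lipschitz function `K : X → ℝ`. -/
theorem smooth_lipschitz_approx_of_lipschitz_on_subset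
    {X : Type*} [NormedAddCommGroup X] [NormedSpace ℝ X] [CompleteSpace X]
    (p : ℕ∞) (hp : 1 ≤ p)
    (hbasis : HasUnconditionalSchauderBasis X)
    (hbump : HasLipschitzSmoothBump X p) :
    ∃ C₀ : ℝ, 1 < C₀ ∧
      ∀ (Y : Set X) (f : Y → ℝ) (η : ℝ), 0 ≤ η →
        (∀ y y' : Y, |f y - f y'| ≤ η * ‖(y : X) - (y' : X)‖) →
        ∀ ε : ℝ, 0 < ε →
          ∃ K : X → ℝ, ContDiff ℝ p K ∧ (∀ y : Y, |f y - K (y : X)| < ε) ∧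
            ∀ x x' : X, |K x - K x'| ≤ C₀ * η * ‖x - x'‖ := by
  have := hbasis.separableSpace
  obtain ⟨C, A, hC, hA, happrox⟩ := hbump.exists_coarse_approx
  refine ⟨C + 2, by linarith, fun Y f η hη hf ε hε => ?_⟩
  obtain ⟨F, hF, hFf⟩ : ∃ F : X → ℝ, (∀ x x', |F x - F x'| ≤ η * ‖x - x'‖) ∧
      ∀ y : Y, F y = f y := by
    have hext : ∀ y : Y, extend Subtype.val f 0 (y : X) = f y :=
      Subtype.val_injective.extend_apply f 0
    have hon : LipschitzOnWith ⟨η, hη⟩ (extend Subtype.val f 0) Y :=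
      LipschitzOnWith.of_dist_le_mul fun x hx y hy => by
        have := hf ⟨x, hx⟩ ⟨y, hy⟩
        rw [← hext, ← hext] at this
        rw [Real.dist_eq, dist_eq_norm]
        exact this
    obtain ⟨F, hF, hEq⟩ := hon.extend_real
    refine ⟨F, fun x x' => ?_, fun y => (hEq y.2).symm.trans (hext y)⟩
    rw [← Real.dist_eq, ← dist_eq_norm]
    exact hF.dist_le_mul x x'
  rcases hη.eq_or_lt with rfl | hη
  · refine ⟨fun _ => F 0, contDiff_const, fun y => ?_, fun x x' => by simp⟩
    have := hF y 0
    rw [zero_mul] at this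
    rw [← hFf]
    exact this.trans_lt hε
  · obtain ⟨s, hs, hsε⟩ : ∃ s : ℝ, 0 < s ∧ η * s * A < ε := by
      refine ⟨ε / (η * (A + 1)), by positivity, ?_⟩
      have : η * (ε / (η * (A + 1))) * A = ε * (A / (A + 1)) := by field_simp
      rw [this]
      exact mul_lt_of_lt_one_right hε ((div_lt_one (by positivity)).2 (by linarith))
    have hηs : 0 < η * s := mul_pos hη hs
    obtain ⟨K, hK, hKlip, hKF⟩ := happrox (fun x => (η * s)⁻¹ * F (s • x)) fun x y => by
      rw [← mul_sub, abs_mul, abs_of_pos (inv_pos.2 hηs), inv_mul_le_iff₀ hηs]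
      refine (hF _ _).trans_eq ?_
      rw [← smul_sub, norm_smul, Real.norm_of_nonneg hs.le, mul_assoc]
    refine ⟨fun x => η * s * K (s⁻¹ • x),
      contDiff_const.mul (hK.comp (contDiff_const_smul _)), fun y => ?_, fun x x' => ?_⟩
    · have h1 := hKF (s⁻¹ • (y : X))
      rw [smul_inv_smul₀ hs.ne', hFf] at h1
      have h2 : f y - η * s * K (s⁻¹ • (y : X)) =
          η * s * ((η * s)⁻¹ * f y - K (s⁻¹ • (y : X))) := by
        rw [mul_sub, mul_inv_cancel_left₀ hηs.ne']
      rw [h2, abs_mul, abs_of_pos hηs]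
      exact (mul_le_mul_of_nonneg_left h1 hηs.le).trans_lt hsε
    · rw [← mul_sub, abs_mul, abs_of_pos hηs]
      have h1 := hKlip (s⁻¹ • x) (s⁻¹ • x')
      rw [← smul_sub, norm_smul, norm_inv, Real.norm_of_nonneg hs.le] at h1
      refine (mul_le_mul_of_nonneg_left h1 hηs.le).trans ?_
      have h2 : η * s * (C * (s⁻¹ * ‖x - x'‖)) = C * η * ‖x - x'‖ := by field_simp
      rw [h2]
      gcongr
      linarith
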